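/- The linear map R_i^{-1} = (P_i q^{-P_i})^{δ(P_i = P_{i+1})} f_i on Λ*W, where f_i is the exterior-algebra homomorphism determined by f_i(e_j) = e_j for j ≠ i, i+1, f_i(e_i) = P_i P_{i+1}(1 - q^{2P_{i+1}}) e_i + P_i q^{P_i} e_{i+1}, f_i(e_{i+1}) = P_{i+1} q^{P_{i+1}} e_i, is invertible, and satisfies the braid relation R_i R_{i+1} R_i = R_{i+1} R_i R_{i+1} in the case P_i = P_{i+1} = P_{i+2} = +1. -/

import Mathlib

set_option synthInstance.maxHeartbeats 1000000
set_option maxHeartbeats 1000000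

noncomputable section

abbrev Rq : Type := RatFunc ℂ
abbrev qq : Rq := RatFunc.X

/-- The two-term elementary map on coordinates `A`, `B`. -/
def elemG {m : ℕ} (A B : Fin m) (a b c : Rq) : Fin m → (Fin m → Rq) := fun j =>
  if j = A then a • Pi.single A (1 : Rq) + b • Pi.single B (1 : Rq)
  else if j = B then c • Pi.single A (1 : Rq)
  else Pi.single j (1 : Rq)

/-- The linear extension of `elemG`. -/
def elemF {m : ℕ} (A B : Fin m) (a b c : Rq) : (Fin m → Rq) →ₗ[Rq] (Fin m → Rq) :=
  ((Pi.basisFun Rq (Fin m)).constr ℕ) (elemG A B a b c)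

theorem elemF_single {m : ℕ} (A B : Fin m) (a b c : Rq) (j : Fin m) :
    elemF A B a b c (Pi.single j (1 : Rq)) = elemG A B a b c j := by
  have h := (Pi.basisFun Rq (Fin m)).constr_basis ℕ (elemG A B a b c) j
  rwa [Pi.basisFun_apply] at h

theorem elemF_A {m : ℕ} (A B : Fin m) (a b c : Rq) :
    elemF A B a b c (Pi.single A (1 : Rq)) =
      a • Pi.single A (1 : Rq) + b • Pi.single B (1 : Rq) := by
  rw [elemF_single]; simp only [elemG, if_true]

theorem elemF_B {m : ℕ} (A B : Fin m) (hAB : A ≠ B) (a b c : Rq) :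
    elemF A B a b c (Pi.single B (1 : Rq)) = c • Pi.single A (1 : Rq) := by
  rw [elemF_single]; simp only [elemG, if_neg hAB.symm, if_true]

theorem elemF_other {m : ℕ} (A B j : Fin m) (hA : j ≠ A) (hB : j ≠ B) (a b c : Rq) :
    elemF A B a b c (Pi.single j (1 : Rq)) = Pi.single j (1 : Rq) := by
  rw [elemF_single]; simp only [elemG, if_neg hA, if_neg hB]

theorem lin_ext {m : ℕ} {f g : (Fin m → Rq) →ₗ[Rq] (Fin m → Rq)}
    (h : ∀ j, f (Pi.single j (1 : Rq)) = g (Pi.single j (1 : Rq))) : f = g := by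
  apply (Pi.basisFun Rq (Fin m)).ext
  intro j
  rw [Pi.basisFun_apply]
  exact h j

/-- An explicit two-sided inverse. -/
theorem elemF_inv {m : ℕ} (A B : Fin m) (hAB : A ≠ B) (a b c : Rq) (hb : b ≠ 0) (hc : c ≠ 0) :
    ∃ G : (Fin m → Rq) →ₗ[Rq] (Fin m → Rq),
      elemF A B a b c ∘ₗ G = LinearMap.id ∧ G ∘ₗ elemF A B a b c = LinearMap.id := by
  refine ⟨elemF B A (-(a * b⁻¹ * c⁻¹)) b⁻¹ c⁻¹, lin_ext fun j => ?_, lin_ext fun j => ?_⟩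
  all_goals
    rw [LinearMap.comp_apply, LinearMap.id_apply]
    by_cases hA : j = A
    · subst hA
      simp only [elemF_A, elemF_B _ _ hAB, elemF_B _ _ hAB.symm, map_add, map_smul]
      exact funext fun x => by
        simp only [Pi.add_apply, Pi.smul_apply, smul_eq_mul]; field_simp; try ring
    · by_cases hB : j = B
      · subst hB
        simp only [elemF_A, elemF_B _ _ hAB, elemF_B _ _ hAB.symm, map_add, map_smul]
        exact funext fun x => by
          simp only [Pi.add_apply, Pi.smul_apply, smul_eq_mul]; field_simp; try ring
      · rw [elemF_other, elemF_other] <;> assumption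

theorem elemF_braid {m : ℕ} (A B C : Fin m) (hAB : A ≠ B) (hBC : B ≠ C) (hAC : A ≠ C) (q : Rq) :
    elemF A B (1 - q ^ 2) q q ∘ₗ elemF B C (1 - q ^ 2) q q ∘ₗ elemF A B (1 - q ^ 2) q q =
    elemF B C (1 - q ^ 2) q q ∘ₗ elemF A B (1 - q ^ 2) q q ∘ₗ elemF B C (1 - q ^ 2) q q := by
  refine lin_ext fun j => ?_
  simp only [LinearMap.comp_apply]
  by_cases hj : j = A ∨ j = B ∨ j = C
  · rcases hj with rfl | rfl | rfl <;>
    simp only [elemF_A, elemF_B _ _ hAB, elemF_B _ _ hBC, elemF_other _ _ _ hAB hAC,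
      elemF_other _ _ _ hAC.symm hBC.symm, map_add, map_smul] <;>
    exact funext fun x => by
      simp only [Pi.add_apply, Pi.smul_apply, smul_eq_mul]; ring
  · push Not at hj
    obtain ⟨h1, h2, h3⟩ := hj
    simp only [elemF_other _ _ _ h1 h2, elemF_other _ _ _ h2 h3]

theorem ext_unit {M : Type} [AddCommGroup M] [Module Rq M] (F G : M →ₗ[Rq] M)
    (h1 : F ∘ₗ G = LinearMap.id) (h2 : G ∘ₗ F = LinearMap.id) (s : Rq) (hs : s ≠ 0) :
    IsUnit (s • (ExteriorAlgebra.map F).toLinearMap : Module.End Rq (ExteriorAlgebra Rq M)) := by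
  have key : ∀ F G : M →ₗ[Rq] M, F ∘ₗ G = LinearMap.id →
      ((ExteriorAlgebra.map F).toLinearMap * (ExteriorAlgebra.map G).toLinearMap :
        Module.End Rq (ExteriorAlgebra Rq M)) = 1 := by
    intro F G h
    rw [Module.End.mul_eq_comp, ← AlgHom.comp_toLinearMap, ExteriorAlgebra.map_comp_map, h,
      ExteriorAlgebra.map_id]
    rfl
  refine ⟨⟨_, s⁻¹ • (ExteriorAlgebra.map G).toLinearMap, ?_, ?_⟩, rfl⟩
  · rw [smul_mul_smul_comm, key _ _ h1, mul_inv_cancel₀ hs, one_smul]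
  · rw [smul_mul_smul_comm, key _ _ h2, inv_mul_cancel₀ hs, one_smul]

theorem ext_braid {M : Type} [AddCommGroup M] [Module Rq M] (F G : M →ₗ[Rq] M)
    (h : F ∘ₗ G ∘ₗ F = G ∘ₗ F ∘ₗ G) (s : Rq) :
    ((s • (ExteriorAlgebra.map F).toLinearMap) * ((s • (ExteriorAlgebra.map G).toLinearMap) *
      (s • (ExteriorAlgebra.map F).toLinearMap)) : Module.End Rq (ExteriorAlgebra Rq M)) =
    (s • (ExteriorAlgebra.map G).toLinearMap) * ((s • (ExteriorAlgebra.map F).toLinearMap) *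
      (s • (ExteriorAlgebra.map G).toLinearMap)) := by
  simp only [smul_mul_smul_comm, Module.End.mul_eq_comp, ← AlgHom.comp_toLinearMap,
    ExteriorAlgebra.map_comp_map, h]

theorem inv_braid {E : Type} [Monoid E] (A B X Y : E) (h1 : A * X = 1) (h2 : X * A = 1)
    (h3 : B * Y = 1) (h4 : Y * B = 1) (h : X * (Y * X) = Y * (X * Y)) :
    A * B * A = B * A * B := by
  have e1 : (A * B * A) * (X * (Y * X)) = 1 := by
    calc _ = A * (B * (A * X) * Y) * X := by simp only [mul_assoc]
      _ = 1 := by simp [h1, h3]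
  have e2 : (Y * (X * Y)) * (B * A * B) = 1 := by
    calc _ = Y * (X * (Y * B) * A) * B := by simp only [mul_assoc]
      _ = 1 := by simp [h2, h4]
  rw [← h] at e2
  exact left_inv_eq_right_inv e1 e2

/-- On `Λ*W` with `W` spanned by `e₁, …, e_{n+1}` and a sign
sequence `P ∈ {±1}ⁿ`, the map `Rᵢ⁻¹ = (Pᵢ q^{-Pᵢ})^{δ(Pᵢ = P_{i+1})} fᵢ` — where `fᵢ`
is the exterior-algebra homomorphism determined by
`fᵢ(eⱼ) = eⱼ` for `j ≠ i, i+1`,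
`fᵢ(eᵢ) = Pᵢ P_{i+1}(1 - q^{2P_{i+1}}) eᵢ + Pᵢ q^{Pᵢ} e_{i+1}`,
`fᵢ(e_{i+1}) = P_{i+1} q^{P_{i+1}} eᵢ` — is invertible; and, in the case
`Pᵢ = P_{i+1} = P_{i+2} = +1`, the inverses `Rᵢ` satisfy the braid relation
`Rᵢ R_{i+1} Rᵢ = R_{i+1} Rᵢ R_{i+1}`. -/
theorem stmt11 {n : ℕ} (P : Fin n → ℤ) (hP : ∀ j, P j = 1 ∨ P j = -1)
    (i : ℕ) (h1 : 0 < i) (h2 : i < n) (h3 : i + 1 < n) :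
    let M : Type := Fin (n + 1) → Rq
    let e : Fin (n + 1) → M := fun j => Pi.single j 1
    -- `Rinv k` for a generic admissible paper-index `k` (our `e` is `0`-indexed:
    -- paper `e_k ↔ e ⟨k-1⟩`)
    let Rinv : (k : ℕ) → 0 < k → k < n → Module.End Rq (ExteriorAlgebra Rq M) :=
      fun k hk1 hk2 =>
        let iA : Fin (n + 1) := ⟨k - 1, by omega⟩
        let iB : Fin (n + 1) := ⟨k, by omega⟩
        let pA : ℤ := P ⟨k - 1, by omega⟩
        let pB : ℤ := P ⟨k, by omega⟩
        let g : Fin (n + 1) → M := fun j =>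
          if j = iA then
            (((pA * pB : ℤ) : Rq) * (1 - qq ^ (2 * pB))) • e iA +
              (((pA : ℤ) : Rq) * qq ^ pA) • e iB
          else if j = iB then (((pB : ℤ) : Rq) * qq ^ pB) • e iA
          else e j
        let fmap : M →ₗ[Rq] M := ((Pi.basisFun Rq (Fin (n + 1))).constr ℕ) g
        (if pA = pB then ((pA : ℤ) : Rq) * qq ^ (-pA) else 1) •
          (ExteriorAlgebra.map fmap).toLinearMap
    IsUnit (Rinv i h1 h2) ∧
    ((∀ j, P j = 1) →
      ∀ A B : Module.End Rq (ExteriorAlgebra Rq M),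
        A * Rinv i h1 h2 = 1 → Rinv i h1 h2 * A = 1 →
        B * Rinv (i + 1) (by omega) h3 = 1 → Rinv (i + 1) (by omega) h3 * B = 1 →
        A * B * A = B * A * B) := by
  have hq : qq ≠ 0 := RatFunc.X_ne_zero
  have hP0 : ∀ j, ((P j : ℤ) : Rq) ≠ 0 := by
    intro j
    rcases hP j with h | h <;> rw [h] <;> simp
  intro M e Rinv
  have hR : ∀ k hk1 hk2, Rinv k hk1 hk2 =
      (if P ⟨k - 1, by omega⟩ = P ⟨k, by omega⟩ then
        ((P ⟨k - 1, by omega⟩ : ℤ) : Rq) * qq ^ (-P ⟨k - 1, by omega⟩) else 1) •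
      (ExteriorAlgebra.map (elemF (m := n + 1) ⟨k - 1, by omega⟩ ⟨k, by omega⟩
        (((P ⟨k - 1, by omega⟩ * P ⟨k, by omega⟩ : ℤ) : Rq) * (1 - qq ^ (2 * P ⟨k, by omega⟩)))
        (((P ⟨k - 1, by omega⟩ : ℤ) : Rq) * qq ^ P ⟨k - 1, by omega⟩)
        (((P ⟨k, by omega⟩ : ℤ) : Rq) * qq ^ P ⟨k, by omega⟩))).toLinearMap :=
    fun k hk1 hk2 => rfl
  clear_value Rinv
  constructor
  · rw [hR]
    obtain ⟨G, g1, g2⟩ := elemF_inv (m := n + 1) ⟨i - 1, by omega⟩ ⟨i, by omega⟩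
      (by simp only [ne_eq, Fin.mk.injEq]; omega)
      (((P ⟨i - 1, by omega⟩ * P ⟨i, by omega⟩ : ℤ) : Rq) * (1 - qq ^ (2 * P ⟨i, by omega⟩)))
      (((P ⟨i - 1, by omega⟩ : ℤ) : Rq) * qq ^ P ⟨i - 1, by omega⟩)
      (((P ⟨i, by omega⟩ : ℤ) : Rq) * qq ^ P ⟨i, by omega⟩)
      (mul_ne_zero (hP0 _) (zpow_ne_zero _ hq)) (mul_ne_zero (hP0 _) (zpow_ne_zero _ hq))
    refine ext_unit _ G g1 g2 _ ?_
    split_ifs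
    · exact mul_ne_zero (hP0 _) (zpow_ne_zero _ hq)
    · exact one_ne_zero
  · intro hP1 A B a1 a2 b1 b2
    refine inv_braid A B _ _ a1 a2 b1 b2 ?_
    simp only [hR, hP1, if_true, Int.cast_one, one_mul, zpow_one, mul_one, Nat.add_sub_cancel]
    refine ext_braid _ _ ?_ _
    refine elemF_braid _ _ _ ?_ ?_ ?_ _ <;> simp only [ne_eq, Fin.mk.injEq] <;> omega


end
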